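/- Let (X,d₁) and (Y,d₂) be 1-bounded pseudometric spaces. Then for all x,x' ∈ X and y,y' ∈ Y, the supremum, over all nonexpansive functions k₁ : X → [0,1] (with respect to d₁ and the Euclidean distance on [0,1]) and all nonexpansive functions k₂ : Y → [0,1] (with respect to d₂), of |min(k₁(x), k₂(y)) − min(k₁(x'), k₂(y'))|, equals max(d₁(x,x'), d₂(y,y')). -/

import Mathlib

open Set

/-- `d` is a pseudometric: `d x x = 0`, symmetry, and the triangle inequality. -/
def IsPseudometric {X : Type*} (d : X → X → ℝ) : Prop :=
  (∀ x, d x x = 0) ∧ (∀ x y, d x y = d y x) ∧ (∀ x y z, d x z ≤ d x y + d y z)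

/-- `d` is 1-bounded: all values are at most `1`. -/
def IsBounded1 {X : Type*} (d : X → X → ℝ) : Prop := ∀ x y, d x y ≤ 1

theorem IsPseudometric.nonneg {X : Type*} {d : X → X → ℝ} (hd : IsPseudometric d) (x y : X) :
    0 ≤ d x y := by
  obtain ⟨h0, hs, ht⟩ := hd
  linarith [h0 x, hs x y, ht x y x]

theorem IsPseudometric.abs_sub_le {X : Type*} {d : X → X → ℝ} (hd : IsPseudometric d)
    (x s t : X) : |d x s - d x t| ≤ d s t := by
  obtain ⟨-, hs, ht⟩ := hd
  rw [abs_le]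
  constructor <;> linarith [hs s t, ht x s t, ht x t s]

theorem statement_10 {X Y : Type*} (d₁ : X → X → ℝ) (d₂ : Y → Y → ℝ)
    (hd₁ : IsPseudometric d₁) (hb₁ : IsBounded1 d₁)
    (hd₂ : IsPseudometric d₂) (hb₂ : IsBounded1 d₂)
    (x x' : X) (y y' : Y) :
    sSup {v : ℝ | ∃ k₁ : X → ℝ, ∃ k₂ : Y → ℝ,
        (∀ t, k₁ t ∈ Icc (0:ℝ) 1) ∧ (∀ s t, |k₁ s - k₁ t| ≤ d₁ s t) ∧
        (∀ t, k₂ t ∈ Icc (0:ℝ) 1) ∧ (∀ s t, |k₂ s - k₂ t| ≤ d₂ s t) ∧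
        v = |min (k₁ x) (k₂ y) - min (k₁ x') (k₂ y')|} =
      max (d₁ x x') (d₂ y y') := by
  refine IsGreatest.csSup_eq ⟨?_, ?_⟩
  · rcases le_total (d₂ y y') (d₁ x x') with h | h
    · refine ⟨d₁ x, fun _ => 1, fun t => ⟨hd₁.nonneg x t, hb₁ x t⟩, hd₁.abs_sub_le x,
        fun _ => ⟨zero_le_one, le_rfl⟩, fun s t => by simpa using hd₂.nonneg s t, ?_⟩
      rw [max_eq_left h, hd₁.1 x, min_eq_left zero_le_one, min_eq_left (hb₁ x x'), zero_sub,
        abs_neg, abs_of_nonneg (hd₁.nonneg x x')]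
    · refine ⟨fun _ => 1, d₂ y, fun _ => ⟨zero_le_one, le_rfl⟩,
        fun s t => by simpa using hd₁.nonneg s t, fun t => ⟨hd₂.nonneg y t, hb₂ y t⟩,
        hd₂.abs_sub_le y, ?_⟩
      rw [max_eq_right h, hd₂.1 y, min_eq_right zero_le_one, min_eq_right (hb₂ y y'), zero_sub,
        abs_neg, abs_of_nonneg (hd₂.nonneg y y')]
  · rintro v ⟨k₁, k₂, -, h₁, -, h₂, rfl⟩
    exact (abs_min_sub_min_le_max _ _ _ _).trans (max_le_max (h₁ x x') (h₂ y y'))
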